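/- Let L be a double Heyting algebra (biheyting algebra), let a, b ∈ L with a ⋖ b, and define c := b \ a (co-Heyting difference) and d := b ⇨ a (Heyting implication). Then (c, d) is a splitting pair in L with c ≤ b and a ≤ d. In particular, b \ a is completely join-prime and b ⇨ a is completely meet-prime, in the sense that for every subset S of L whose supremum exists, c ≤ sup S implies c ≤ s for some s ∈ S, and dually for d with infima. -/

import Mathlib

/-- A pair `(c, d)` of elements of a lattice is a *splitting pair* if every `x`
satisfies exactly one of `c ≤ x` and `x ≤ d`. -/
def IsSplittingPair {L : Type*} [Preorder L] (c d : L) : Prop :=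
  ∀ x : L, (c ≤ x ∨ x ≤ d) ∧ ¬(c ≤ x ∧ x ≤ d)

theorem IsSplittingPair.exists_le_of_isLUB {L : Type*} [Preorder L] {c d : L}
    (h : IsSplittingPair c d) {S : Set L} {s : L} (hs : IsLUB S s) (hc : c ≤ s) :
    ∃ x ∈ S, c ≤ x := by
  by_contra! hS
  exact (h s).2 ⟨hc, hs.2 fun x hx => (h x).1.resolve_left (hS x hx)⟩

theorem IsSplittingPair.exists_le_of_isGLB {L : Type*} [Preorder L] {c d : L}
    (h : IsSplittingPair c d) {S : Set L} {s : L} (hs : IsGLB S s) (hd : s ≤ d) :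
    ∃ x ∈ S, x ≤ d := by
  by_contra! hS
  exact (h s).2 ⟨hs.2 fun x hx => (h x).1.resolve_right (hS x hx), hd⟩

theorem CovBy.isSplittingPair_sdiff_himp {L : Type*} [BiheytingAlgebra L] {a b : L}
    (hab : a ⋖ b) : IsSplittingPair (b \ a) (b ⇨ a) := by
  intro x
  rw [sdiff_le_iff, le_himp_iff]
  constructor
  · rcases hab.eq_or_eq (c := a ⊔ x ⊓ b) le_sup_left (sup_le hab.le inf_le_right) with h | h
    · exact Or.inr (sup_eq_left.mp h)
    · exact Or.inl (h.ge.trans (sup_le_sup_left inf_le_left a))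
  · rintro ⟨hc, hd⟩
    refine hab.lt.not_ge ?_
    calc b ≤ (a ⊔ x) ⊓ b := le_inf hc le_rfl
      _ = a ⊓ b ⊔ x ⊓ b := inf_sup_right a x b
      _ ≤ a := sup_le inf_le_left hd

/-- Theorem 2.11 (Theorem `thm:DoubHeyt-cov2splitting`): let `L` be a double Heyting
(biheyting) algebra and `a ⋖ b` in `L`.  With `c := b \ a` and `d := b ⇨ a`, the
pair `(c, d)` is a splitting pair with `c ≤ b` and `a ≤ d`; in particular `b \ a`
is completely join-prime and `b ⇨ a` is completely meet-prime. -/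
theorem splitting_pair_of_covby_biheyting {L : Type*} [BiheytingAlgebra L]
    (a b : L) (hab : a ⋖ b) :
    IsSplittingPair (b \ a) (b ⇨ a) ∧ b \ a ≤ b ∧ a ≤ b ⇨ a ∧
      (∀ (S : Set L) (s : L), IsLUB S s → b \ a ≤ s → ∃ x ∈ S, b \ a ≤ x) ∧
      (∀ (S : Set L) (s : L), IsGLB S s → s ≤ b ⇨ a → ∃ x ∈ S, x ≤ b ⇨ a) := by
  have h := hab.isSplittingPair_sdiff_himp
  exact ⟨h, sdiff_le, le_himp, fun _ _ => h.exists_le_of_isLUB, fun _ _ => h.exists_le_of_isGLB⟩
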